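/- Let (ρ_n)_{n≥1} be a sequence of positive real numbers such that ρ_n decreases to 0, ρ_{n+1} < ρ_n/10 for all n, and 2^n·(log(1/ρ_n))^(−s) → 0 as n → ∞ for every s > 0. Then there exists a set K ⊆ (1, 2) such that: (1) K is compact, perfect, and totally disconnected (a Cantor set); (2) the family of real numbers given by the elements of K is linearly independent over ℚ; (3) for each n, K can be covered by 2^n closed intervals each of diameter at most ρ_n; (4) for every s > 0 the generalized Hausdorff measure H^{h_s}(K) with gauge h_s(r) = (log(1/r))^(−s) equals 0, i.e. K has logarithmic Hausdorff dimension 0. -/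

import Mathlib

open Filter Set Metric Pointwise

/-- The gauge `h_s(r) = (log(1/r))^(-s)` as a function `ℝ≥0∞ → ℝ≥0∞`, used to build
the generalized (logarithmic) Hausdorff measure via Carathéodory's metric construction. -/
noncomputable def hGauge (s : ℝ) : ENNReal → ENNReal :=
  fun r => ENNReal.ofReal ((Real.log (1 / r.toReal)) ^ (-s))

/-- A set covered, for each `n ≥ 1`, by `2 ^ n` intervals of diameter at most `ρ n` is null for the
logarithmic gauge `h_s` as soon as `2 ^ n * h_s (ρ n) → 0`. -/
theorem mkMetric_hGauge_eq_zero_of_cover {K : Set ℝ} {ρ : ℕ → ℝ} {s : ℝ} (hs : 0 < s)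
    (hρpos : ∀ n, 1 ≤ n → 0 < ρ n) (hρ0 : Tendsto ρ atTop (nhds 0))
    (hρs : Tendsto (fun n : ℕ => (2 : ℝ) ^ n * (Real.log (1 / ρ n)) ^ (-s)) atTop (nhds 0))
    (hcov : ∀ n : ℕ, 1 ≤ n → ∃ c d : ℕ → ℝ,
      K ⊆ ⋃ k ∈ Finset.range (2 ^ n), Set.Icc (c k) (d k) ∧
      ∀ k < 2 ^ n, d k - c k ≤ ρ n) :
    MeasureTheory.Measure.mkMetric (hGauge s) K = 0 := by
  choose! c d hK hcd using hcov
  have hdiam : ∀ n, 1 ≤ n → ∀ k : Fin (2 ^ n),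
      ediam (Icc (c n k) (d n k)) ≤ ENNReal.ofReal (ρ n) := fun n hn k => by
    rw [Real.ediam_Icc]
    exact ENNReal.ofReal_le_ofReal (hcd n hn k k.2)
  have hle := MeasureTheory.Measure.mkMetric_le_liminf_sum K (l := atTop)
    (fun n => ENNReal.ofReal (ρ n)) (by simpa using ENNReal.tendsto_ofReal hρ0)
    (fun n (k : Fin (2 ^ n)) => Icc (c n k) (d n k))
    ((eventually_ge_atTop 1).mono hdiam)
    ((eventually_ge_atTop 1).mono fun n hn x hx => by
      obtain ⟨k, hk, hxk⟩ := mem_iUnion₂.1 (hK n hn hx)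
      exact mem_iUnion.2 ⟨⟨k, Finset.mem_range.1 hk⟩, hxk⟩)
    (hGauge s)
  have hzero : Tendsto
      (fun n => ∑ k : Fin (2 ^ n), hGauge s (ediam (Icc (c n k) (d n k)))) atTop (nhds 0) := by
    have hlim := ENNReal.tendsto_ofReal hρs
    rw [ENNReal.ofReal_zero] at hlim
    refine tendsto_of_tendsto_of_tendsto_of_le_of_le' tendsto_const_nhds hlim
      (Eventually.of_forall fun _ => zero_le) ?_
    filter_upwards [eventually_ge_atTop 1, hρ0.eventually_lt_const one_pos] with n hn hn1
    have hgauge : ∀ k : Fin (2 ^ n), hGauge s (ediam (Icc (c n k) (d n k))) ≤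
        ENNReal.ofReal ((Real.log (1 / ρ n)) ^ (-s)) := fun k => by
      have hr : (ediam (Icc (c n k) (d n k))).toReal ≤ ρ n :=
        ENNReal.toReal_le_of_le_ofReal (hρpos n hn).le (hdiam n hn k)
      rw [hGauge]
      rcases (ENNReal.toReal_nonneg (a := ediam (Icc (c n k) (d n k)))).eq_or_lt with h0 | h0
      · rw [← h0, div_zero, Real.log_zero, Real.zero_rpow (neg_ne_zero.2 hs.ne')]
        simp
      · refine ENNReal.ofReal_le_ofReal (Real.rpow_le_rpow_of_nonpos ?_ ?_ (neg_nonpos.2 hs.le))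
        · exact Real.log_pos ((one_lt_div (hρpos n hn)).2 hn1)
        · exact Real.log_le_log (one_div_pos.2 (hρpos n hn)) (one_div_le_one_div_of_le h0 hr)
    refine (Finset.sum_le_card_nsmul _ _ _ fun k _ => hgauge k).trans_eq ?_
    rw [Finset.card_univ, Fintype.card_fin, nsmul_eq_mul, ENNReal.ofReal_mul (by positivity),
      ENNReal.ofReal_pow zero_le_two]
    simp
  exact le_antisymm (hle.trans_eq hzero.liminf_eq) zero_le

section Gap

variable {p : ℕ → ℕ}

theorem add_le_of_gap (hp : ∀ j, p j + j + 2 ≤ p (j + 1)) (J j : ℕ) : p J + j ≤ p (J + j) := by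
  induction j with
  | zero => simp
  | succ j ih => have := hp (J + j); rw [← add_assoc J]; omega

theorem half_pow_gap_le (hp : ∀ j, p j + j + 2 ≤ p (j + 1)) (J j : ℕ) :
    (1 / 2 : ℝ) ^ p (J + j) ≤ (1 / 2) ^ p J * (1 / 2) ^ j := by
  rw [← pow_add]
  exact pow_le_pow_of_le_one (by norm_num) (by norm_num) (add_le_of_gap hp J j)

theorem summable_half_pow_gap (hp : ∀ j, p j + j + 2 ≤ p (j + 1)) (J : ℕ) :
    Summable fun j => (1 / 2 : ℝ) ^ p (J + j) :=
  .of_nonneg_of_le (fun _ => by positivity) (half_pow_gap_le hp J)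
    (summable_geometric_two.mul_left _)

theorem tsum_half_pow_gap_le (hp : ∀ j, p j + j + 2 ≤ p (j + 1)) (J : ℕ) :
    ∑' j, (1 / 2 : ℝ) ^ p (J + j) ≤ 2 * (1 / 2) ^ p J := by
  refine ((summable_half_pow_gap hp J).tsum_le_tsum (half_pow_gap_le hp J)
    (summable_geometric_two.mul_left _)).trans_eq ?_
  rw [tsum_mul_left, tsum_geometric_two, mul_comm]

/-- A vanishing series `∑ u j * 2 ^ (-p j)` with bounded integer digits `u j` and increasingly
sparse exponents `p j` has only finitely many nonzero digits. -/
theorem eventually_eq_zero_of_hasSum_gap (hp : ∀ j, p j + j + 2 ≤ p (j + 1)) {u : ℕ → ℤ} {M : ℝ}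
    (hu : ∀ j, |(u j : ℝ)| ≤ M) (h : HasSum (fun j => (u j : ℝ) * (1 / 2) ^ p j) 0) :
    ∀ᶠ j in atTop, u j = 0 := by
  set S : ℕ → ℝ := fun J => ∑ j ∈ Finset.range J, (u j : ℝ) * (1 / 2) ^ p j with hS
  have hM : 0 ≤ M := (abs_nonneg _).trans (hu 0)
  have hmono : Monotone p := monotone_nat_of_le_succ fun j => by have := hp j; omega
  have hint : ∀ J, ∃ N : ℤ, S (J + 1) = N * (1 / 2) ^ p J := fun J => by
    refine ⟨∑ j ∈ Finset.range (J + 1), u j * 2 ^ (p J - p j), ?_⟩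
    push_cast
    rw [hS, Finset.sum_mul]
    refine Finset.sum_congr rfl fun j hj => ?_
    have hle : p j ≤ p J := hmono (by simpa [Nat.lt_succ_iff] using hj)
    obtain ⟨e, he⟩ := Nat.exists_eq_add_of_le hle
    rw [he, Nat.add_sub_cancel_left, pow_add, mul_assoc, mul_left_comm (2 ^ e : ℝ), ← mul_pow]
    norm_num
  have hbound : ∀ J, |S (J + 1)| ≤ M * (1 / 2) ^ J * (1 / 2) ^ p J := fun J => by
    have hsplit := h.summable.sum_add_tsum_nat_add (J + 1)
    rw [h.tsum_eq] at hsplit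
    have hterm : ∀ j, ‖(u (j + (J + 1)) : ℝ) * (1 / 2) ^ p (j + (J + 1))‖ ≤
        M * (1 / 2) ^ p (J + 1 + j) := fun j => by
      rw [norm_mul, Real.norm_eq_abs, add_comm j, Real.norm_of_nonneg (by positivity)]
      exact mul_le_mul_of_nonneg_right (hu _) (by positivity)
    have htail := tsum_of_norm_bounded
      ((summable_half_pow_gap hp (J + 1)).hasSum.mul_left M) hterm
    rw [show S (J + 1) = _ from eq_neg_of_add_eq_zero_left hsplit, abs_neg]
    refine htail.trans ?_
    have hstep : (1 / 2 : ℝ) ^ p (J + 1) ≤ (1 / 2) ^ (p J + J + 2) :=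
      pow_le_pow_of_le_one (by norm_num) (by norm_num) (hp J)
    have hpos : (0 : ℝ) ≤ (1 / 2) ^ p J * (1 / 2) ^ J := by positivity
    rw [mul_assoc]
    refine mul_le_mul_of_nonneg_left ((tsum_half_pow_gap_le hp (J + 1)).trans ?_) hM
    rw [pow_add, pow_add] at hstep
    linarith
  have hsmall : ∀ᶠ J : ℕ in atTop, M * (1 / 2) ^ J < 1 := by
    have hlim := (tendsto_pow_atTop_nhds_zero_of_lt_one (r := (1 / 2 : ℝ)) (by norm_num)
      (by norm_num)).const_mul M
    rw [mul_zero] at hlim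
    exact hlim.eventually_lt_const one_pos
  have hSzero : ∀ᶠ J : ℕ in atTop, S (J + 1) = 0 := by
    filter_upwards [hsmall] with J hJ
    obtain ⟨N, hN⟩ := hint J
    have hpos : (0 : ℝ) < (1 / 2) ^ p J := by positivity
    have hle := hbound J
    rw [hN, abs_mul, abs_of_pos hpos] at hle
    have hlt : |(N : ℝ)| < 1 := (le_of_mul_le_mul_right hle hpos).trans_lt hJ
    have : N = 0 := Int.abs_lt_one_iff.1 (by exact_mod_cast hlt)
    simp [hN, this]
  obtain ⟨J₀, hJ₀⟩ := eventually_atTop.1 hSzero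
  refine eventually_atTop.2 ⟨J₀ + 1, fun j hj => ?_⟩
  obtain ⟨i, rfl⟩ := Nat.exists_eq_add_of_le' (by omega : 1 ≤ j)
  have hsucc : S (i + 1 + 1) = S (i + 1) + (u (i + 1) : ℝ) * (1 / 2) ^ p (i + 1) :=
    Finset.sum_range_succ _ _
  rw [hJ₀ (i + 1) (by omega), hJ₀ i (by omega), zero_add, zero_eq_mul] at hsucc
  exact_mod_cast hsucc.resolve_right (by positivity)

end Gap

/-- The code of the length-`n` prefix of `σ`: distinct finite binary words get distinct codes. -/
def prefixCode (σ : ℕ → Bool) : ℕ → ℕ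
  | 0 => 0
  | n + 1 => 2 * prefixCode σ n + 1 + (σ n).toNat

theorem prefixCode_strictMono (σ : ℕ → Bool) : StrictMono (prefixCode σ) :=
  strictMono_nat_of_lt_succ fun n => by rw [prefixCode]; omega

theorem prefixCode_bounds (σ : ℕ → Bool) (n : ℕ) :
    2 ^ n ≤ prefixCode σ n + 1 ∧ prefixCode σ n + 1 < 2 * 2 ^ n := by
  induction n with
  | zero => simp [prefixCode]
  | succ n ih => have := (σ n).toNat_lt; rw [prefixCode, pow_succ]; omega

theorem eq_of_prefixCode_eq {σ τ : ℕ → Bool} {m n : ℕ} (h : prefixCode σ m = prefixCode τ n) :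
    m = n := by
  have hσ := prefixCode_bounds σ m
  have hτ := prefixCode_bounds τ n
  rw [h] at hσ
  rcases lt_trichotomy m n with hmn | hmn | hmn
  · have := Nat.pow_le_pow_right two_pos (Nat.succ_le_of_lt hmn)
    rw [Nat.pow_succ] at this; omega
  · exact hmn
  · have := Nat.pow_le_pow_right two_pos (Nat.succ_le_of_lt hmn)
    rw [Nat.pow_succ] at this; omega

theorem prefix_eq_of_prefixCode_eq {σ τ : ℕ → Bool} {n : ℕ}
    (h : prefixCode σ n = prefixCode τ n) {m : ℕ} (hm : m < n) :
    prefixCode σ m = prefixCode τ m ∧ σ m = τ m := by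
  induction n with
  | zero => omega
  | succ n ih =>
    rw [prefixCode, prefixCode] at h
    have hσ := (σ n).toNat_lt
    have hτ := (τ n).toNat_lt
    have hn : prefixCode σ n = prefixCode τ n := by omega
    rcases Nat.lt_succ_iff_lt_or_eq.1 hm with hlt | rfl
    · exact ih hn hlt
    · refine ⟨hn, ?_⟩
      have : (σ m).toNat = (τ m).toNat := by omega
      revert this
      cases σ m <;> cases τ m <;> simp

theorem continuous_prefixCode (n : ℕ) : Continuous fun σ => prefixCode σ n := by
  induction n with
  | zero => exact continuous_const
  | succ n ih =>
    exact ((continuous_const.mul ih).add continuous_const).add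
      ((continuous_of_discreteTopology (f := Bool.toNat)).comp (continuous_apply n))

/-- Distinct branches eventually visit disjoint sets of codes. -/
theorem eventually_notMem_range_prefixCode {σ τ : ℕ → Bool} (h : σ ≠ τ) :
    ∀ᶠ n in atTop, prefixCode σ n ∉ range (prefixCode τ) := by
  obtain ⟨m, hm⟩ := Function.ne_iff.1 h
  filter_upwards [eventually_gt_atTop m] with n hn
  rintro ⟨k, hk⟩
  obtain rfl := eq_of_prefixCode_eq hk
  exact hm (prefix_eq_of_prefixCode_eq hk hn).2.symm

/-- The point of the Cantor set on the branch `σ`: its binary digits are `1` exactly at the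
positions `p j`, where `j` runs through the codes of the prefixes of `σ`. -/
noncomputable def branchPoint (p : ℕ → ℕ) (σ : ℕ → Bool) : ℝ :=
  ∑' n, (1 / 2 : ℝ) ^ p (prefixCode σ n)

section BranchPoint

variable {p : ℕ → ℕ}

theorem half_pow_prefixCode_le (hp : ∀ j, p j + j + 2 ≤ p (j + 1)) (σ : ℕ → Bool) (n : ℕ) :
    (1 / 2 : ℝ) ^ p (prefixCode σ n) ≤ (1 / 2) ^ p n :=
  have hmono : Monotone p := monotone_nat_of_le_succ fun j => by have := hp j; omega
  pow_le_pow_of_le_one (by norm_num) (by norm_num)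
    (hmono ((prefixCode_strictMono σ).le_apply (x := n)))

theorem summable_half_pow_prefixCode (hp : ∀ j, p j + j + 2 ≤ p (j + 1)) (σ : ℕ → Bool) :
    Summable fun n => (1 / 2 : ℝ) ^ p (prefixCode σ n) :=
  .of_nonneg_of_le (fun _ => by positivity) (half_pow_prefixCode_le hp σ)
    (by simpa using summable_half_pow_gap hp 0)

theorem continuous_branchPoint (hp : ∀ j, p j + j + 2 ≤ p (j + 1)) :
    Continuous (branchPoint p) := by
  refine continuous_tsum (u := fun n => (1 / 2 : ℝ) ^ p n) (fun n => ?_)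
    (by simpa using summable_half_pow_gap hp 0) fun n σ => ?_
  · exact (continuous_of_discreteTopology (f := fun j => (1 / 2 : ℝ) ^ p j)).comp
      (continuous_prefixCode n)
  · rw [Real.norm_of_nonneg (by positivity)]
    exact half_pow_prefixCode_le hp σ n

theorem branchPoint_mem_Icc (hp : ∀ j, p j + j + 2 ≤ p (j + 1)) (σ : ℕ → Bool) (n : ℕ) :
    branchPoint p σ ∈ Icc (∑ m ∈ Finset.range n, (1 / 2 : ℝ) ^ p (prefixCode σ m))
      ((∑ m ∈ Finset.range n, (1 / 2 : ℝ) ^ p (prefixCode σ m)) + 2 * (1 / 2) ^ p n) := by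
  rw [branchPoint, ← (summable_half_pow_prefixCode hp σ).sum_add_tsum_nat_add n]
  refine ⟨le_add_of_nonneg_right (tsum_nonneg fun _ => by positivity), ?_⟩
  gcongr
  refine le_trans ?_ (tsum_half_pow_gap_le hp n)
  refine Summable.tsum_le_tsum (fun j => ?_)
    ((summable_nat_add_iff n).2 (summable_half_pow_prefixCode hp σ)) (summable_half_pow_gap hp n)
  rw [add_comm n]
  exact half_pow_prefixCode_le hp σ (j + n)

theorem branchPoint_mem_Ioo (hp : ∀ j, p j + j + 2 ≤ p (j + 1)) (hp0 : p 0 = 0) (σ : ℕ → Bool) :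
    branchPoint p σ ∈ Ioo (1 : ℝ) 2 := by
  obtain ⟨h2, -⟩ := branchPoint_mem_Icc hp σ 2
  obtain ⟨-, h1⟩ := branchPoint_mem_Icc hp σ 1
  have hpos : (0 : ℝ) < (1 / 2) ^ p (prefixCode σ 1) := by positivity
  have hsmall : (1 / 2 : ℝ) ^ p 1 ≤ (1 / 2) ^ 2 :=
    pow_le_pow_of_le_one (by norm_num) (by norm_num) (by simpa [hp0] using hp 0)
  rw [Finset.sum_range_succ] at h2
  rw [Finset.sum_range_one, prefixCode, hp0, pow_zero] at h1 h2
  constructor <;> linarith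

theorem hasSum_indicator_branchPoint (hp : ∀ j, p j + j + 2 ≤ p (j + 1)) (σ : ℕ → Bool) :
    HasSum (fun j => (indicator (range (prefixCode σ)) 1 j : ℝ) * (1 / 2) ^ p j)
      (branchPoint p σ) := by
  have h := (summable_half_pow_prefixCode hp σ).hasSum
  rw [← (prefixCode_strictMono σ).injective.hasSum_iff
    (g := prefixCode σ) (f := fun j => (indicator (range (prefixCode σ)) 1 j : ℝ) * (1 / 2) ^ p j)
    fun j hj => by simp [hj]]
  simpa [Function.comp_def, branchPoint] using h

theorem linearIndependent_branchPoint (hp : ∀ j, p j + j + 2 ≤ p (j + 1)) :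
    LinearIndependent ℚ (branchPoint p) := by
  rw [← LinearIndependent.iff_fractionRing ℤ ℚ, linearIndependent_iff']
  intro t k hk σ hσ
  set u : ℕ → ℤ := fun j => ∑ τ ∈ t, k τ * indicator (range (prefixCode τ)) 1 j with hu
  have hsum : HasSum (fun j => (u j : ℝ) * (1 / 2) ^ p j) 0 := by
    have h := hasSum_sum (s := t) fun τ _ =>
      (hasSum_indicator_branchPoint hp τ).mul_left (k τ : ℝ)
    simp_rw [← zsmul_eq_mul (branchPoint p _)] at h
    rw [hk] at h
    refine h.congr_fun fun j => ?_
    simp only [hu]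
    push_cast
    rw [Finset.sum_mul]
    refine Finset.sum_congr rfl fun τ _ => ?_
    by_cases hj : j ∈ range (prefixCode τ) <;> simp [hj]
  have hbound : ∀ j, |(u j : ℝ)| ≤ ∑ τ ∈ t, |(k τ : ℝ)| := fun j => by
    rw [hu]
    push_cast
    refine (Finset.abs_sum_le_sum_abs _ _).trans (Finset.sum_le_sum fun τ _ => ?_)
    by_cases hj : j ∈ range (prefixCode τ) <;> simp [hj]
  have hzero := (prefixCode_strictMono σ).tendsto_atTop.eventually
    (eventually_eq_zero_of_hasSum_gap hp hbound hsum)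
  have hdisj : ∀ᶠ n in atTop, ∀ τ ∈ t, τ ≠ σ → prefixCode σ n ∉ range (prefixCode τ) :=
    (eventually_all_finset t).2 fun τ _ =>
      eventually_imp_distrib_left.2 fun h => eventually_notMem_range_prefixCode h.symm
  obtain ⟨n, hn, hd⟩ := (hzero.and hdisj).exists
  simp only [hu] at hn
  rw [Finset.sum_eq_single_of_mem σ hσ fun τ hτ hne => by simp [hd τ hτ hne]] at hn
  simpa using hn

theorem exists_cover_range_branchPoint (hp : ∀ j, p j + j + 2 ≤ p (j + 1)) (n : ℕ) :
    ∃ c : ℕ → ℝ, range (branchPoint p) ⊆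
      ⋃ k ∈ Finset.range (2 ^ n), Icc (c k) (c k + 2 * (1 / 2) ^ p n) := by
  have hleft : ∀ k, ∃ x : ℝ, ∀ σ, prefixCode σ n + 1 = 2 ^ n + k →
      x = ∑ m ∈ Finset.range n, (1 / 2 : ℝ) ^ p (prefixCode σ m) := fun k => by
    by_cases hk : ∃ τ, prefixCode τ n + 1 = 2 ^ n + k
    · obtain ⟨τ, hτ⟩ := hk
      refine ⟨∑ m ∈ Finset.range n, (1 / 2 : ℝ) ^ p (prefixCode τ m), fun σ hσ => Finset.sum_congr rfl fun m hm => ?_⟩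
      rw [(prefix_eq_of_prefixCode_eq (σ := τ) (τ := σ) (by omega) (Finset.mem_range.1 hm)).1]
    · exact ⟨0, fun σ hσ => absurd ⟨σ, hσ⟩ hk⟩
  choose c hc using hleft
  refine ⟨c, ?_⟩
  rintro _ ⟨σ, rfl⟩
  obtain ⟨hlo, hhi⟩ := prefixCode_bounds σ n
  refine mem_iUnion₂.2 ⟨prefixCode σ n + 1 - 2 ^ n, Finset.mem_range.2 (by omega), ?_⟩
  rw [hc _ σ (by omega)]
  exact branchPoint_mem_Icc hp σ n

end BranchPoint

theorem perfect_range_of_continuous_injective {X : Type*} [TopologicalSpace X] [T2Space X]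
    {f : (ℕ → Bool) → X} (hf : Continuous f) (hinj : Function.Injective f) :
    Perfect (range f) := by
  refine ⟨(isCompact_range hf).isClosed, ?_⟩
  rintro _ ⟨σ, rfl⟩
  rw [accPt_iff_frequently]
  have hlim : Tendsto (fun n => Function.update σ n (!σ n)) atTop (nhds σ) := by
    refine tendsto_pi_nhds.2 fun i => tendsto_const_nhds.congr' ?_
    filter_upwards [eventually_gt_atTop i] with n hn
    rw [Function.update_of_ne hn.ne]
  refine ((hf.tendsto σ).comp hlim).frequently (Frequently.of_forall fun n => ⟨?_, mem_range_self _⟩)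
  refine hinj.ne (Function.ne_iff.2 ⟨n, ?_⟩)
  simp

/-- Sparse exponents whose associated dyadic scales are dominated by `ρ`. -/
theorem exists_gap_exponents {ρ : ℕ → ℝ} (hρpos : ∀ n, 1 ≤ n → 0 < ρ n) :
    ∃ p : ℕ → ℕ, p 0 = 0 ∧ (∀ j, p j + j + 2 ≤ p (j + 1)) ∧
      ∀ n, 1 ≤ n → 2 * (1 / 2 : ℝ) ^ p n ≤ ρ n := by
  have hq : ∀ n, ∃ q : ℕ, 1 ≤ n → (1 / 2 : ℝ) ^ q < ρ n / 2 := fun n => by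
    by_cases hn : 1 ≤ n
    · obtain ⟨q, hq⟩ := exists_pow_lt_of_lt_one (half_pos (hρpos n hn)) (y := (1 / 2 : ℝ))
        (by norm_num)
      exact ⟨q, fun _ => hq⟩
    · exact ⟨0, fun h => absurd h hn⟩
  choose q hq using hq
  refine ⟨fun j => ∑ i ∈ Finset.range j, (q (i + 1) + i + 2), by simp, fun j => ?_, fun n hn => ?_⟩
  · simp only [Finset.sum_range_succ]; omega
  · obtain ⟨j, rfl⟩ := Nat.exists_eq_add_of_le' hn
    have hle : (1 / 2 : ℝ) ^ (∑ i ∈ Finset.range (j + 1), (q (i + 1) + i + 2)) ≤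
        (1 / 2) ^ q (j + 1) :=
      pow_le_pow_of_le_one (by norm_num) (by norm_num)
        (by rw [Finset.sum_range_succ]; omega)
    have := hq (j + 1) hn
    linarith

/-- The nonempty form of the theorem: since `Perfect` allows the empty set, nonemptiness of the
Cantor set is recorded separately. -/
theorem exists_nonempty_rationally_independent_cantor_set
    {ρ : ℕ → ℝ} (hρpos : ∀ n, 1 ≤ n → 0 < ρ n) (hρ0 : Tendsto ρ atTop (nhds 0))
    (hρs : ∀ s : ℝ, 0 < s →
      Tendsto (fun n : ℕ => (2 : ℝ) ^ n * (Real.log (1 / ρ n)) ^ (-s)) atTop (nhds 0)) :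
    ∃ K : Set ℝ, K.Nonempty ∧ K ⊆ Set.Ioo (1 : ℝ) 2 ∧
      IsCompact K ∧ Perfect K ∧ IsTotallyDisconnected K ∧
      LinearIndependent ℚ ((↑) : K → ℝ) ∧
      (∀ n : ℕ, 1 ≤ n → ∃ c d : ℕ → ℝ,
        K ⊆ ⋃ k ∈ Finset.range (2 ^ n), Set.Icc (c k) (d k) ∧
        ∀ k < 2 ^ n, d k - c k ≤ ρ n) ∧
      (∀ s : ℝ, 0 < s → MeasureTheory.Measure.mkMetric (hGauge s) K = 0) := by
  obtain ⟨p, hp0, hp, hpρ⟩ := exists_gap_exponents hρpos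
  have hcont := continuous_branchPoint hp
  have hli := linearIndependent_branchPoint hp
  have hcov : ∀ n : ℕ, 1 ≤ n → ∃ c d : ℕ → ℝ,
      range (branchPoint p) ⊆ ⋃ k ∈ Finset.range (2 ^ n), Set.Icc (c k) (d k) ∧
      ∀ k < 2 ^ n, d k - c k ≤ ρ n := fun n hn => by
    obtain ⟨c, hc⟩ := exists_cover_range_branchPoint hp n
    exact ⟨c, _, hc, fun k _ => by rw [add_sub_cancel_left]; exact hpρ n hn⟩
  refine ⟨range (branchPoint p), range_nonempty _, range_subset_iff.2 (branchPoint_mem_Ioo hp hp0),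
    isCompact_range hcont, perfect_range_of_continuous_injective hcont hli.injective,
    (hcont.isClosedEmbedding hli.injective).isEmbedding.isTotallyDisconnected_range.2 inferInstance,
    hli.linearIndepOn_id, hcov, fun s hs =>
      mkMetric_hGauge_eq_zero_of_cover hs hρpos hρ0 (hρs s hs) hcov⟩

/-- Given scales `ρ n` decreasing to `0` with `ρ (n+1) < ρ n / 10` and
`2^n (log(1/ρ n))^{-s} → 0` for every `s > 0`, there is a Cantor set `K ⊆ (1,2)` which is
linearly independent over `ℚ`, is covered for each `n ≥ 1` by `2^n` closed intervals of
diameter at most `ρ n`, and has `H^{h_s}(K) = 0` for every `s > 0`. -/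
theorem rationally_independent_cantor_set
    (ρ : ℕ → ℝ) (hρpos : ∀ n, 1 ≤ n → 0 < ρ n)
    (hρdec : ∀ n, 1 ≤ n → ρ (n + 1) < ρ n / 10)
    (hρ0 : Tendsto ρ atTop (nhds 0))
    (hρs : ∀ s : ℝ, 0 < s →
      Tendsto (fun n : ℕ => (2 : ℝ) ^ n * (Real.log (1 / ρ n)) ^ (-s)) atTop (nhds 0)) :
    ∃ K : Set ℝ, K ⊆ Set.Ioo (1 : ℝ) 2 ∧
      IsCompact K ∧ Perfect K ∧ IsTotallyDisconnected K ∧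
      LinearIndependent ℚ ((↑) : K → ℝ) ∧
      (∀ n : ℕ, 1 ≤ n → ∃ c d : ℕ → ℝ,
        K ⊆ ⋃ k ∈ Finset.range (2 ^ n), Set.Icc (c k) (d k) ∧
        ∀ k < 2 ^ n, d k - c k ≤ ρ n) ∧
      (∀ s : ℝ, 0 < s → MeasureTheory.Measure.mkMetric (hGauge s) K = 0) := by
  exact (exists_nonempty_rationally_independent_cantor_set hρpos hρ0 hρs).imp fun _ hK => hK.2
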